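/- A binary sextic over an algebraically closed field of characteristic ≠ 2,3,5 has a root of multiplicity at least four if and only if the basic invariants I_2, I_4, I_6, I_10 all vanish on it. -/

import Mathlib

open MvPolynomial
noncomputable section

/-- The binary form of degree `d` with coefficient vector `a`. -/
def toForm (k : Type*) [CommSemiring k] (d : ℕ) (a : Fin (d+1) → k) :
    MvPolynomial (Fin 2) k :=
  ∑ i : Fin (d+1), C (a i) * X 0 ^ (d - (i : ℕ)) * X 1 ^ (i : ℕ)

/-- Coordinate change by the matrix `g` : `X ↦ g00 X + g01 Y`, `Y ↦ g10 X + g11 Y`. -/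
def matAct (k : Type*) [CommSemiring k] (g : Matrix (Fin 2) (Fin 2) k)
    (p : MvPolynomial (Fin 2) k) : MvPolynomial (Fin 2) k :=
  aeval (fun j : Fin 2 => C (g j 0) * X 0 + C (g j 1) * X 1) p

/-- The coefficient of `X^(d-i) Y^i` in a binary form of degree `d`. -/
def formCoeff (k : Type*) [CommSemiring k] (d : ℕ) (p : MvPolynomial (Fin 2) k)
    (i : Fin (d+1)) : k :=
  coeff (Finsupp.single 0 (d - (i : ℕ)) + Finsupp.single 1 (i : ℕ)) p

/-- The induced action of a `2×2` matrix on the coefficient vector of a binary form. -/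
def actCoeff (k : Type*) [CommSemiring k] (d : ℕ) (g : Matrix (Fin 2) (Fin 2) k)
    (a : Fin (d+1) → k) : Fin (d+1) → k :=
  formCoeff k d (matAct k g (toForm k d a))

/-- `P ∈ k[A_0,…,A_d]` is an `SL₂(k)`-invariant. -/
def SL2Invariant (k : Type*) [CommRing k] (d : ℕ)
    (P : MvPolynomial (Fin (d+1)) k) : Prop :=
  ∀ g : Matrix.SpecialLinearGroup (Fin 2) k, ∀ a : Fin (d+1) → k,
    eval (actCoeff k d (g : Matrix (Fin 2) (Fin 2) k) a) P = eval a P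

/-- The ring `R_d` of `SL₂(k)`-invariants in `k[A_0,…,A_d]`. -/
def Rd (k : Type*) [Field k] (d : ℕ) : Subalgebra k (MvPolynomial (Fin (d+1)) k) where
  carrier := {P | SL2Invariant k d P}
  mul_mem' := fun hP hQ g a => by simp only [map_mul]; rw [hP g a, hQ g a]
  add_mem' := fun hP hQ g a => by simp only [map_add]; rw [hP g a, hQ g a]
  algebraMap_mem' := fun r g a => by simp [SL2Invariant]
open scoped Classical

/-- `D_{ij} = x_i y_j - x_j y_i` for the roots `(x_i , y_i)` of a binary sextic. -/
def Dij {k : Type*} [CommRing k] (x y : Fin 6 → k) (i j : Fin 6) : k :=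
  x i * y j - x j * y i

/-- `Σ D_{ij}² D_{kl}² D_{mn}²`, the sum running over the 15 partitions of `{1,…,6}`
into three pairs (each partition counted 48 times by permutations). -/
def sumPairs {k : Type*} [Field k] (x y : Fin 6 → k) : k :=
  (48 : k)⁻¹ * ∑ σ : Equiv.Perm (Fin 6),
    (Dij x y (σ 0) (σ 1))^2 * (Dij x y (σ 2) (σ 3))^2 * (Dij x y (σ 4) (σ 5))^2

/-- `Σ D_{ij}² D_{jk}² D_{ki}² D_{lm}² D_{mn}² D_{nl}²`, the sum running over the
10 partitions of `{1,…,6}` into two 3-sets (each counted 72 times by permutations). -/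
def sumB {k : Type*} [Field k] (x y : Fin 6 → k) : k :=
  (72 : k)⁻¹ * ∑ σ : Equiv.Perm (Fin 6),
    ((Dij x y (σ 0) (σ 1))^2 * (Dij x y (σ 1) (σ 2))^2 * (Dij x y (σ 2) (σ 0))^2)
    * ((Dij x y (σ 3) (σ 4))^2 * (Dij x y (σ 4) (σ 5))^2 * (Dij x y (σ 5) (σ 3))^2)

/-- The 60-term sum over pairs of matched triangles (each matched configuration
counted 12 times by permutations). -/
def sumC {k : Type*} [Field k] (x y : Fin 6 → k) : k :=
  (12 : k)⁻¹ * ∑ σ : Equiv.Perm (Fin 6),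
    ((Dij x y (σ 0) (σ 1))^2 * (Dij x y (σ 1) (σ 2))^2 * (Dij x y (σ 2) (σ 0))^2)
    * ((Dij x y (σ 3) (σ 4))^2 * (Dij x y (σ 4) (σ 5))^2 * (Dij x y (σ 5) (σ 3))^2)
    * ((Dij x y (σ 0) (σ 3))^2 * (Dij x y (σ 1) (σ 4))^2 * (Dij x y (σ 2) (σ 5))^2)

/-- The basic invariant `I₂` of a binary sextic, expressed through the roots, in the
normalization used by the paper's coefficient formulas. -/
def I2r {k : Type*} [Field k] (x y : Fin 6 → k) : k :=
  -(2 : k)⁻¹ * sumPairs x y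

/-- The basic invariant `I₄` (`= 4I₂² - B` in the paper's normalization of `B`),
expressed through the roots. -/
def I4r {k : Type*} [Field k] (x y : Fin 6 → k) : k :=
  9 * (I2r x y)^2 - 80 * sumB x y

/-- The basic invariant `I₆` (`= 8I₂³ - 160 I₂ I₄ - C` in the paper's normalization
of `C`), expressed through the roots. -/
def I6r {k : Type*} [Field k] (x y : Fin 6 → k) : k :=
  (13/108 : k) * (I2r x y)^3 - (1/108 : k) * I2r x y * I4r x y + (25/9 : k) * sumC x y

/-- The discriminant `I₁₀ = ∏_{i<j} D_{ij}²`. -/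
def I10r {k : Type*} [Field k] (x y : Fin 6 → k) : k :=
  ∏ p ∈ Finset.univ.filter (fun p : Fin 6 × Fin 6 => p.1 < p.2), (Dij x y p.1 p.2)^2

/-- The coefficient of `X^(6-j) Y^j` in the sextic `∏ (y_i X - x_i Y)`. -/
def sexticCoeff {k : Type*} [Field k] (x y : Fin 6 → k) (j : Fin 7) : k :=
  formCoeff k 6 (∏ i : Fin 6,
    (MvPolynomial.C (y i) * MvPolynomial.X 0 - MvPolynomial.C (x i) * MvPolynomial.X 1)) j

/-- The multiplicity of the `i`-th root among the six roots of the sextic. -/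
def rootMult {k : Type*} [Field k] (x y : Fin 6 → k) (i : Fin 6) : ℕ :=
  (Finset.univ.filter (fun j => x i * y j = x j * y i)).card

theorem perm6 {k : Type*} [Field k] (F : Fin 6 → Fin 6 → Fin 6 → Fin 6 → Fin 6 → Fin 6 → k) :
  ∑ σ : Equiv.Perm (Fin 6), F (σ 0) (σ 1) (σ 2) (σ 3) (σ 4) (σ 5) = 
  ∑ a, ∑ b, ∑ c, ∑ d, ∑ e, ∑ f, if [a,b,c,d,e,f].Nodup then F a b c d e f else 0 := by
  have key : ∀ G : Fin 6 × Fin 6 × Fin 6 × Fin 6 × Fin 6 × Fin 6 → k, 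
    ∑ a, ∑ b, ∑ c, ∑ d, ∑ e, ∑ f, G (a,b,c,d,e,f) = ∑ p, G p := by
    intro G
    simp only [Fintype.sum_prod_type]
  rw [key (fun p => if [p.1,p.2.1,p.2.2.1,p.2.2.2.1,p.2.2.2.2.1,p.2.2.2.2.2].Nodup then 
    F p.1 p.2.1 p.2.2.1 p.2.2.2.1 p.2.2.2.2.1 p.2.2.2.2.2 else 0), ← Finset.sum_filter]
  refine Finset.sum_bij (fun σ _ => (σ 0, σ 1, σ 2, σ 3, σ 4, σ 5)) ?_ ?_ ?_ ?_
  · intro σ _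
    simp
  · intro σ _ τ _ h
    simp at h
    ext i
    fin_cases i <;> simp [h]
  · rintro ⟨a,b,c,d,e,f⟩ h
    simp only [Finset.mem_filter, Finset.mem_univ, true_and] at h
    have hinj : Function.Injective ![a,b,c,d,e,f] := by
      rw [← List.nodup_ofFn]
      simpa using h
    exact ⟨Equiv.ofBijective _ (Finite.injective_iff_bijective.mp hinj), Finset.mem_univ _, rfl⟩
  · intro σ _
    rfl

set_option maxRecDepth 100000 in
set_option maxHeartbeats 40000000 in
theorem perm_pairs {k : Type*} [Field k] (E : Fin 6 → Fin 6 → k) (hs : ∀ i j, E i j = E j i) :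
  ∑ σ : Equiv.Perm (Fin 6), E (σ 0) (σ 1) * E (σ 2) (σ 3) * E (σ 4) (σ 5) = 
   48 * (E 0 1 * (E 2 3 * E 4 5 + E 2 4 * E 3 5 + E 2 5 * E 3 4)
   + E 0 2 * (E 1 3 * E 4 5 + E 1 4 * E 3 5 + E 1 5 * E 3 4)
   + E 0 3 * (E 1 2 * E 4 5 + E 1 4 * E 2 5 + E 1 5 * E 2 4)
   + E 0 4 * (E 1 2 * E 3 5 + E 1 3 * E 2 5 + E 1 5 * E 2 3)
   + E 0 5 * (E 1 2 * E 3 4 + E 1 3 * E 2 4 + E 1 4 * E 2 3)) := by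
  rw [perm6 (fun a b c d e f => E a b * E c d * E e f)]
  simp [Fin.sum_univ_six]
  simp only [hs 1 0, hs 2 0, hs 3 0, hs 4 0, hs 5 0, hs 2 1, hs 3 1, hs 4 1, hs 5 1, hs 3 2,
    hs 4 2, hs 5 2, hs 4 3, hs 5 3, hs 5 4]
  ring

set_option maxRecDepth 100000 in
set_option maxHeartbeats 40000000 in
theorem perm_B {k : Type*} [Field k] (E : Fin 6 → Fin 6 → k)
    (u : Fin 6 → k) (w : Fin 6 → Fin 6 → k) (t : k)
    (hs : ∀ i j, E i j = E j i) (h01 : E 0 1 = 0)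
    (h0 : ∀ i, E 0 i = u i) (h1 : ∀ i, E 1 i = t * u i)
    (hw : ∀ i j, 2 ≤ i → 2 ≤ j → E i j = u i * u j * w i j) :
    ∑ σ : Equiv.Perm (Fin 6), (E (σ 0) (σ 1) * E (σ 1) (σ 2) * E (σ 2) (σ 0))
      * (E (σ 3) (σ 4) * E (σ 4) (σ 5) * E (σ 5) (σ 3)) =
    144 * t ^ 2 * (u 2 * u 3 * u 4 * u 5) ^ 2 * (w 2 3 * w 4 5 + w 2 4 * w 3 5 + w 2 5 * w 3 4) := by
  have a23 := hw 2 3 (by decide) (by decide)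
  have a24 := hw 2 4 (by decide) (by decide)
  have a25 := hw 2 5 (by decide) (by decide)
  have a34 := hw 3 4 (by decide) (by decide)
  have a35 := hw 3 5 (by decide) (by decide)
  have a45 := hw 4 5 (by decide) (by decide)
  rw [perm6 (fun a b c d e f => (E a b * E b c * E c a) * (E d e * E e f * E f d))]
  simp [Fin.sum_univ_six]
  simp only [hs 1 0, hs 2 0, hs 3 0, hs 4 0, hs 5 0, hs 2 1, hs 3 1, hs 4 1, hs 5 1, hs 3 2,
    hs 4 2, hs 5 2, hs 4 3, hs 5 3, hs 5 4, h01, zero_mul, mul_zero, zero_add, add_zero]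
  simp only [h0 2, h0 3, h0 4, h0 5, h1 2, h1 3, h1 4, h1 5, a23, a24, a25, a34, a35, a45]
  ring

set_option maxRecDepth 100000 in
set_option maxHeartbeats 40000000 in
theorem perm_C {k : Type*} [Field k] (E : Fin 6 → Fin 6 → k)
    (u : Fin 6 → k) (w : Fin 6 → Fin 6 → k) (t : k)
    (hs : ∀ i j, E i j = E j i) (h01 : E 0 1 = 0)
    (h0 : ∀ i, E 0 i = u i) (h1 : ∀ i, E 1 i = t * u i)
    (hw : ∀ i j, 2 ≤ i → 2 ≤ j → E i j = u i * u j * w i j) :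
    ∑ σ : Equiv.Perm (Fin 6), (E (σ 0) (σ 1) * E (σ 1) (σ 2) * E (σ 2) (σ 0))
      * (E (σ 3) (σ 4) * E (σ 4) (σ 5) * E (σ 5) (σ 3))
      * (E (σ 0) (σ 3) * E (σ 1) (σ 4) * E (σ 2) (σ 5)) =
    24 * t ^ 3 * (u 2 * u 3 * u 4 * u 5) ^ 3 * (w 2 3 * w 3 4 * w 4 5
      + w 2 3 * w 3 5 * w 4 5
      + w 2 4 * w 3 4 * w 3 5
      + w 2 4 * w 4 5 * w 3 5
      + w 2 5 * w 3 5 * w 3 4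
      + w 2 5 * w 4 5 * w 3 4
      + w 2 3 * w 2 4 * w 4 5
      + w 2 3 * w 2 5 * w 4 5
      + w 3 4 * w 2 4 * w 2 5
      + w 3 5 * w 2 5 * w 2 4
      + w 2 4 * w 2 3 * w 3 5
      + w 3 4 * w 2 3 * w 2 5) := by
  have a23 := hw 2 3 (by decide) (by decide)
  have a24 := hw 2 4 (by decide) (by decide)
  have a25 := hw 2 5 (by decide) (by decide)
  have a34 := hw 3 4 (by decide) (by decide)
  have a35 := hw 3 5 (by decide) (by decide)
  have a45 := hw 4 5 (by decide) (by decide)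
  rw [perm6 (fun a b c d e f => (E a b * E b c * E c a) * (E d e * E e f * E f d)
    * (E a d * E b e * E c f))]
  simp [Fin.sum_univ_six]
  simp only [hs 1 0, hs 2 0, hs 3 0, hs 4 0, hs 5 0, hs 2 1, hs 3 1, hs 4 1, hs 5 1, hs 3 2,
    hs 4 2, hs 5 2, hs 4 3, hs 5 3, hs 5 4, h01, zero_mul, mul_zero, zero_add, add_zero]
  simp only [h0 2, h0 3, h0 4, h0 5, h1 2, h1 3, h1 4, h1 5, a23, a24, a25, a34, a35, a45]
  ring


/-- A depressed quartic all of whose reduced invariants vanish is `z^4`. -/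
theorem quartic_aux {k : Type*} [Field k] (h2 : (2 : k) ≠ 0) (h3 : (3 : k) ≠ 0)
    (a b c d : k) (hsum : a + b + c + d = 0)
    (hP : (a - b) ^ 2 + (a - c) ^ 2 + (a - d) ^ 2 + (b - c) ^ 2 + (b - d) ^ 2 + (c - d) ^ 2 = 0)
    (hQ : (a - b) ^ 2 * (c - d) ^ 2 + (a - c) ^ 2 * (b - d) ^ 2 + (a - d) ^ 2 * (b - c) ^ 2 = 0)
    (hR : (a - b) ^ 2 * (b - c) ^ 2 * (c - d) ^ 2
      + (a - b) ^ 2 * (b - d) ^ 2 * (c - d) ^ 2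
      + (a - c) ^ 2 * (b - c) ^ 2 * (b - d) ^ 2
      + (a - c) ^ 2 * (c - d) ^ 2 * (b - d) ^ 2
      + (a - d) ^ 2 * (b - d) ^ 2 * (b - c) ^ 2
      + (a - d) ^ 2 * (c - d) ^ 2 * (b - c) ^ 2
      + (a - b) ^ 2 * (a - c) ^ 2 * (c - d) ^ 2
      + (a - b) ^ 2 * (a - d) ^ 2 * (c - d) ^ 2
      + (b - c) ^ 2 * (a - c) ^ 2 * (a - d) ^ 2
      + (b - d) ^ 2 * (a - d) ^ 2 * (a - c) ^ 2
      + (a - c) ^ 2 * (a - b) ^ 2 * (b - d) ^ 2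
      + (b - c) ^ 2 * (a - b) ^ 2 * (a - d) ^ 2 = 0) :
    a = 0 ∧ b = 0 ∧ c = 0 ∧ d = 0 := by
  obtain rfl : d = -(a + b + c) := by linear_combination hsum
  obtain ⟨e2, he2⟩ : ∃ e2, e2 = a * b + a * c + b * c - (a + b + c) ^ 2 := ⟨_, rfl⟩
  obtain ⟨e3, he3⟩ : ∃ e3, e3 = a * b * c - (a * b + a * c + b * c) * (a + b + c) := ⟨_, rfl⟩
  obtain ⟨e4, he4⟩ : ∃ e4, e4 = -(a * b * c * (a + b + c)) := ⟨_, rfl⟩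
  have z2 : e2 = 0 := by
    have : (2 : k) ^ 3 * e2 = 0 := by rw [he2]; linear_combination -hP
    simpa [h2] using this
  have z4 : e4 = 0 := by
    have : (2 : k) ^ 3 * 3 * e4 = 0 := by
      have : (2 : k) ^ 3 * 3 * e4 + 2 * e2 ^ 2 = 0 := by rw [he2, he4]; linear_combination hQ
      simpa [z2] using this
    simpa [h2, h3] using this
  have z3 : e3 = 0 := by
    have : (2 : k) * 3 ^ 2 * e3 ^ 2 = 0 := by
      have : (2 : k) * 3 ^ 2 * e3 ^ 2 + 12 * e2 ^ 3 + 80 * e2 * e4 = 0 := by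
        rw [he2, he3, he4]; linear_combination -hR
      simpa [z2] using this
    simpa [h2, h3] using this
  have key : ∀ z : k, (z - a) * (z - b) * (z - c) * (z + (a + b + c)) = 0 → z = 0 := by
    intro z hz
    have : z ^ 4 = 0 := by
      have : z ^ 4 + e2 * z ^ 2 - e3 * z + e4 = 0 := by
        rw [he2, he3, he4]; linear_combination hz
      simpa [z2, z3, z4] using this
    simpa using this
  exact ⟨key _ (by ring), key _ (by ring), key _ (by ring), key _ (by ring)⟩

theorem quartic_main {k : Type*} [Field k] (h2 : (2 : k) ≠ 0) (h3 : (3 : k) ≠ 0)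
    (a b c d : k)
    (hP : (a - b) ^ 2 + (a - c) ^ 2 + (a - d) ^ 2 + (b - c) ^ 2 + (b - d) ^ 2 + (c - d) ^ 2 = 0)
    (hQ : (a - b) ^ 2 * (c - d) ^ 2 + (a - c) ^ 2 * (b - d) ^ 2 + (a - d) ^ 2 * (b - c) ^ 2 = 0)
    (hR : (a - b) ^ 2 * (b - c) ^ 2 * (c - d) ^ 2
      + (a - b) ^ 2 * (b - d) ^ 2 * (c - d) ^ 2
      + (a - c) ^ 2 * (b - c) ^ 2 * (b - d) ^ 2
      + (a - c) ^ 2 * (c - d) ^ 2 * (b - d) ^ 2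
      + (a - d) ^ 2 * (b - d) ^ 2 * (b - c) ^ 2
      + (a - d) ^ 2 * (c - d) ^ 2 * (b - c) ^ 2
      + (a - b) ^ 2 * (a - c) ^ 2 * (c - d) ^ 2
      + (a - b) ^ 2 * (a - d) ^ 2 * (c - d) ^ 2
      + (b - c) ^ 2 * (a - c) ^ 2 * (a - d) ^ 2
      + (b - d) ^ 2 * (a - d) ^ 2 * (a - c) ^ 2
      + (a - c) ^ 2 * (a - b) ^ 2 * (b - d) ^ 2
      + (b - c) ^ 2 * (a - b) ^ 2 * (a - d) ^ 2 = 0) :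
    a = b ∧ a = c ∧ a = d := by
  obtain ⟨m, hm⟩ : ∃ m : k, 4 * m = a + b + c + d := by
    have h4 : (4 : k) ≠ 0 := by
      have : (4 : k) = 2 * 2 := by norm_num
      rw [this]; exact mul_ne_zero h2 h2
    exact ⟨(a + b + c + d) / 4, by field_simp⟩
  obtain ⟨ha, hb, hc, hd⟩ := quartic_aux h2 h3 (a - m) (b - m) (c - m) (d - m)
    (by linear_combination -hm) (by simpa using hP) (by simpa using hQ) (by simpa using hR)
  exact ⟨by linear_combination ha - hb, by linear_combination ha - hc,
    by linear_combination ha - hd⟩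

theorem rootMult_ge {k : Type*} [Field k] (x y : Fin 6 → k) (i a b c d : Fin 6)
    (hn : [a, b, c, d].Nodup)
    (ha : x i * y a = x a * y i) (hb : x i * y b = x b * y i)
    (hc : x i * y c = x c * y i) (hd : x i * y d = x d * y i) :
    4 ≤ rootMult x y i := by
  have hcard : ([a, b, c, d].toFinset).card = 4 := by
    rw [List.toFinset_card_of_nodup hn]; rfl
  rw [← hcard]
  unfold rootMult
  apply Finset.card_le_card
  intro j hj
  simp only [List.mem_toFinset, List.mem_cons, List.not_mem_nil, or_false] at hj
  simp only [Finset.mem_filter, Finset.mem_univ, true_and]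
  rcases hj with rfl | rfl | rfl | rfl <;> assumption

theorem core {k : Type*} [Field k] (h2 : (2 : k) ≠ 0) (h3 : (3 : k) ≠ 0)
    (x y : Fin 6 → k) (hroots : ∀ i, (x i, y i) ≠ (0, 0)) (h01 : Dij x y 0 1 = 0)
    (hA : ∑ σ : Equiv.Perm (Fin 6),
      (Dij x y (σ 0) (σ 1))^2 * (Dij x y (σ 2) (σ 3))^2 * (Dij x y (σ 4) (σ 5))^2 = 0)
    (hB : ∑ σ : Equiv.Perm (Fin 6),
      ((Dij x y (σ 0) (σ 1))^2 * (Dij x y (σ 1) (σ 2))^2 * (Dij x y (σ 2) (σ 0))^2)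
      * ((Dij x y (σ 3) (σ 4))^2 * (Dij x y (σ 4) (σ 5))^2 * (Dij x y (σ 5) (σ 3))^2) = 0)
    (hC : ∑ σ : Equiv.Perm (Fin 6),
      ((Dij x y (σ 0) (σ 1))^2 * (Dij x y (σ 1) (σ 2))^2 * (Dij x y (σ 2) (σ 0))^2)
      * ((Dij x y (σ 3) (σ 4))^2 * (Dij x y (σ 4) (σ 5))^2 * (Dij x y (σ 5) (σ 3))^2)
      * ((Dij x y (σ 0) (σ 3))^2 * (Dij x y (σ 1) (σ 4))^2 * (Dij x y (σ 2) (σ 5))^2) = 0) :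
    ∃ i, 4 ≤ rootMult x y i := by
  obtain ⟨p, q, hpq⟩ : ∃ p q : k, x 0 * q - y 0 * p = 1 := by
    by_cases hx : x 0 = 0
    · have hy : y 0 ≠ 0 := fun h => hroots 0 (by rw [hx, h])
      exact ⟨-(y 0)⁻¹, 0, by field_simp; ring⟩
    · exact ⟨0, (x 0)⁻¹, by field_simp; ring⟩
  obtain ⟨X, hX⟩ : ∃ X : Fin 6 → k, ∀ i, X i = x i * q - y i * p := ⟨_, fun _ => rfl⟩
  obtain ⟨Y, hY⟩ : ∃ Y : Fin 6 → k, ∀ i, Y i = x 0 * y i - x i * y 0 := ⟨_, fun _ => rfl⟩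
  have hD : ∀ i j, Dij x y i j = X i * Y j - X j * Y i := by
    intro i j
    rw [hX, hX, hY, hY, Dij]
    linear_combination (-(x i * y j - x j * y i)) * hpq
  have hXY : ∀ i, Y i = 0 → X i ≠ 0 := by
    intro i hYi hXi
    apply hroots i
    rw [hX] at hXi
    rw [hY] at hYi
    ext
    · show x i = 0
      linear_combination x 0 * hXi + p * hYi - x i * hpq
    · show y i = 0
      linear_combination y 0 * hXi + q * hYi - y i * hpq
  have hX0 : X 0 = 1 := by rw [hX]; exact hpq
  have hY0 : Y 0 = 0 := by rw [hY]; ring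
  have hY1 : Y 1 = 0 := by rw [hY]; exact h01
  have hX1 := hXY 1 hY1
  have hpar : ∀ i, Y i = 0 → x 0 * y i = x i * y 0 := by
    intro i hi
    rw [hY] at hi
    linear_combination hi
  have h48 : (48 : k) ≠ 0 := by
    have : (48 : k) = 2 ^ 4 * 3 := by norm_num
    rw [this]; simp [h2, h3]
  have hA' := hA
  rw [perm_pairs (fun i j => (Dij x y i j) ^ 2) (fun i j => by unfold Dij; ring)] at hA'
  simp only [hD, hX0, hY0, hY1] at hA'
  have h6 : (6 : k) ≠ 0 := by
    have : (6 : k) = 2 * 3 := by norm_num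
    rw [this]; simp [h2, h3]
  have hpar0 := hpar 0 hY0
  have hpar1 := hpar 1 hY1
  by_cases hY2 : Y 2 = 0
  · have hx2 := hXY 2 hY2
    have : 48 * (6 * X 1 ^ 2 * X 2 ^ 2 * Y 3 ^ 2 * Y 4 ^ 2 * Y 5 ^ 2) = 0 := by
      rw [← hA', hY2]; ring
    simp [h48, h6, hX1, hx2] at this
    rcases this with (h | h) | h
    · exact ⟨0, rootMult_ge x y 0 0 1 2 3 (by decide) hpar0 hpar1 (hpar 2 hY2) (hpar _ h)⟩
    · exact ⟨0, rootMult_ge x y 0 0 1 2 4 (by decide) hpar0 hpar1 (hpar 2 hY2) (hpar _ h)⟩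
    · exact ⟨0, rootMult_ge x y 0 0 1 2 5 (by decide) hpar0 hpar1 (hpar 2 hY2) (hpar _ h)⟩
  by_cases hY3 : Y 3 = 0
  · have hx3 := hXY 3 hY3
    have : 48 * (6 * X 1 ^ 2 * X 3 ^ 2 * Y 2 ^ 2 * Y 4 ^ 2 * Y 5 ^ 2) = 0 := by
      rw [← hA', hY3]; ring
    simp [h48, h6, hX1, hx3, hY2] at this
    rcases this with h | h
    · exact ⟨0, rootMult_ge x y 0 0 1 3 4 (by decide) hpar0 hpar1 (hpar 3 hY3) (hpar _ h)⟩
    · exact ⟨0, rootMult_ge x y 0 0 1 3 5 (by decide) hpar0 hpar1 (hpar 3 hY3) (hpar _ h)⟩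
  by_cases hY4 : Y 4 = 0
  · have hx4 := hXY 4 hY4
    have : 48 * (6 * X 1 ^ 2 * X 4 ^ 2 * Y 2 ^ 2 * Y 3 ^ 2 * Y 5 ^ 2) = 0 := by
      rw [← hA', hY4]; ring
    simp [h48, h6, hX1, hx4, hY2, hY3] at this
    exact ⟨0, rootMult_ge x y 0 0 1 4 5 (by decide) hpar0 hpar1 (hpar 4 hY4) (hpar _ this)⟩
  by_cases hY5 : Y 5 = 0
  · have hx5 := hXY 5 hY5
    have : 48 * (6 * X 1 ^ 2 * X 5 ^ 2 * Y 2 ^ 2 * Y 3 ^ 2 * Y 4 ^ 2) = 0 := by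
      rw [← hA', hY5]; ring
    simp [h48, h6, hX1, hx5, hY2, hY3, hY4] at this
  have hYne : ∀ i : Fin 6, 2 ≤ i → Y i ≠ 0 := by
    intro i hi
    fin_cases i
    · exact absurd hi (by decide)
    · exact absurd hi (by decide)
    all_goals assumption
  obtain ⟨z, hz⟩ : ∃ z : Fin 6 → k, ∀ i, 2 ≤ i → X i = z i * Y i := by
    refine ⟨fun i => X i / Y i, fun i hi => ?_⟩
    have := hYne i hi
    field_simp
  have hs : ∀ i j, (fun i j => (Dij x y i j) ^ 2) i j = (fun i j => (Dij x y i j) ^ 2) j i :=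
    fun i j => by simp only [Dij]; ring
  have hw : ∀ i j, 2 ≤ i → 2 ≤ j → (fun i j => (Dij x y i j) ^ 2) i j
      = (fun i => Y i ^ 2) i * (fun i => Y i ^ 2) j * (fun i j => (z i - z j) ^ 2) i j := by
    intro i j hi hj
    simp only [hD, hz i hi, hz j hj]
    ring
  have e0 : ∀ i, (fun i j => (Dij x y i j) ^ 2) 0 i = (fun i => Y i ^ 2) i := by
    intro i
    simp only [hD, hX0, hY0]; ring
  have e1 : ∀ i, (fun i j => (Dij x y i j) ^ 2) 1 i = X 1 ^ 2 * (fun i => Y i ^ 2) i := by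
    intro i
    simp only [hD, hY1]; ring
  rw [perm_B (fun i j => (Dij x y i j) ^ 2) (fun i => Y i ^ 2) (fun i j => (z i - z j) ^ 2)
    (X 1 ^ 2) hs (by simp [h01]) e0 e1 hw] at hB
  rw [perm_C (fun i j => (Dij x y i j) ^ 2) (fun i => Y i ^ 2) (fun i j => (z i - z j) ^ 2)
    (X 1 ^ 2) hs (by simp [h01]) e0 e1 hw] at hC
  have hyy : (Y 2 ^ 2 * Y 3 ^ 2 * Y 4 ^ 2 * Y 5 ^ 2) ≠ 0 := by simp [hY2, hY3, hY4, hY5]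
  have c144 : (144 : k) ≠ 0 := by
    have : (144 : k) = 2 ^ 4 * 3 ^ 2 := by norm_num
    rw [this]; simp [h2, h3]
  have c24 : (24 : k) ≠ 0 := by
    have : (24 : k) = 2 ^ 3 * 3 := by norm_num
    rw [this]; simp [h2, h3]
  have c96 : (96 : k) ≠ 0 := by
    have : (96 : k) = 2 ^ 5 * 3 := by norm_num
    rw [this]; simp [h2, h3]
  have hB' := (mul_eq_zero.mp hB).resolve_left
    (mul_ne_zero (mul_ne_zero c144 (pow_ne_zero _ (pow_ne_zero _ hX1))) (pow_ne_zero _ hyy))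
  have hC' := (mul_eq_zero.mp hC).resolve_left
    (mul_ne_zero (mul_ne_zero c24 (pow_ne_zero _ (pow_ne_zero _ hX1))) (pow_ne_zero _ hyy))
  rw [hz 2 (by decide), hz 3 (by decide), hz 4 (by decide), hz 5 (by decide)] at hA'
  have hA2 : 96 * X 1 ^ 2 * (Y 2 ^ 2 * Y 3 ^ 2 * Y 4 ^ 2 * Y 5 ^ 2) *
      ((z 2 - z 3) ^ 2 + (z 2 - z 4) ^ 2 + (z 2 - z 5) ^ 2 + (z 3 - z 4) ^ 2 + (z 3 - z 5) ^ 2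
        + (z 4 - z 5) ^ 2) = 0 := by
    rw [← hA']; ring
  have hA3 := (mul_eq_zero.mp hA2).resolve_left
    (mul_ne_zero (mul_ne_zero c96 (pow_ne_zero _ hX1)) hyy)
  obtain ⟨z3, z4, z5⟩ := quartic_main h2 h3 (z 2) (z 3) (z 4) (z 5) hA3 hB' hC'
  have fin : ∀ j, 2 ≤ j → z 2 = z j → x 2 * y j = x j * y 2 := by
    intro j hj hzj
    have := hD 2 j
    rw [hz 2 (by decide), hz j hj, hzj, Dij] at this
    linear_combination this
  exact ⟨2, rootMult_ge x y 2 2 3 4 5 (by decide) rfl (fin 3 (by decide) z3)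
    (fin 4 (by decide) z4) (fin 5 (by decide) z5)⟩

theorem rootMult_perm {k : Type*} [Field k] (x y : Fin 6 → k) (τ : Equiv.Perm (Fin 6))
    (i : Fin 6) : rootMult (x ∘ τ) (y ∘ τ) i = rootMult x y (τ i) := by
  unfold rootMult
  refine Finset.card_bij (fun j _ => τ j) ?_ ?_ ?_
  · intro j hj
    simpa using hj
  · intro a _ b _ h
    exact τ.injective h
  · intro b hb
    exact ⟨τ.symm b, by simpa using hb, by simp⟩

theorem pigeon : ∀ p : Fin 6 → Bool, 4 ≤ (Finset.univ.filter (fun i => p i = true)).card →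
    ((p 0 ∧ p 1) ∨ (p 2 ∧ p 3) ∨ (p 4 ∧ p 5)) ∧
    ((p 0 ∧ p 1) ∨ (p 1 ∧ p 2) ∨ (p 2 ∧ p 0) ∨ (p 3 ∧ p 4) ∨ (p 4 ∧ p 5) ∨ (p 5 ∧ p 3)) := by
  decide

theorem perm_move : ∀ i j : Fin 6, i < j →
    (Equiv.swap 0 i * Equiv.swap 1 (Equiv.swap 0 i j)) 0 = i ∧
    (Equiv.swap 0 i * Equiv.swap 1 (Equiv.swap 0 i j)) 1 = j := by
  decide

theorem forward {k : Type*} [Field k]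
    (x y : Fin 6 → k) (hroots : ∀ i, (x i, y i) ≠ (0, 0)) (i : Fin 6)
    (hi : 4 ≤ rootMult x y i) (σ : Equiv.Perm (Fin 6)) :
    ((Dij x y (σ 0) (σ 1) = 0) ∨ (Dij x y (σ 2) (σ 3) = 0) ∨ (Dij x y (σ 4) (σ 5) = 0)) ∧
    ((Dij x y (σ 0) (σ 1) = 0) ∨ (Dij x y (σ 1) (σ 2) = 0) ∨ (Dij x y (σ 2) (σ 0) = 0) ∨
    (Dij x y (σ 3) (σ 4) = 0) ∨ (Dij x y (σ 4) (σ 5) = 0) ∨ (Dij x y (σ 5) (σ 3) = 0)) := by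
  have hD : ∀ a b, x i * y a = x a * y i → x i * y b = x b * y i → Dij x y a b = 0 := by
    intro a b ha hb
    unfold Dij
    by_cases hx : x i = 0
    · have hy : y i ≠ 0 := fun h => hroots i (by rw [hx, h])
      apply mul_left_cancel₀ hy
      linear_combination y a * hb - y b * ha
    · apply mul_left_cancel₀ hx
      linear_combination x a * hb - x b * ha
  have hcard : 4 ≤ (Finset.univ.filter
      (fun j => decide (x i * y (σ j) = x (σ j) * y i) = true)).card := by
    refine hi.trans (le_of_eq ?_)
    rw [← Equiv.apply_symm_apply σ i, ← rootMult_perm, rootMult]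
    simp
  have := pigeon (fun j => decide (x i * y (σ j) = x (σ j) * y i)) hcard
  simp only [decide_eq_true_eq] at this
  obtain ⟨h1, h2⟩ := this
  constructor
  · rcases h1 with h | h | h
    · exact Or.inl (hD _ _ h.1 h.2)
    · exact Or.inr (Or.inl (hD _ _ h.1 h.2))
    · exact Or.inr (Or.inr (hD _ _ h.1 h.2))
  · rcases h2 with h | h | h | h | h | h
    all_goals
      have := hD _ _ h.1 h.2
      simp only [this, true_or, or_true]

/-- A binary sextic has a root of multiplicity at least four iff its basic invariants
`I₂, I₄, I₆, I₁₀` all vanish. -/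
theorem sextic_quadruple_root_iff_invariants_vanish
    (k : Type*) [Field k] [IsAlgClosed k]
    (h2 : (2 : k) ≠ 0) (h3 : (3 : k) ≠ 0) (h5 : (5 : k) ≠ 0)
    (x y : Fin 6 → k) (hroots : ∀ i, (x i, y i) ≠ (0, 0)) :
    (∃ i, 4 ≤ rootMult x y i) ↔
      (I2r x y = 0 ∧ I4r x y = 0 ∧ I6r x y = 0 ∧ I10r x y = 0) := by
  have h48 : (48 : k) ≠ 0 := by
    have : (48 : k) = 2 ^ 4 * 3 := by norm_num
    rw [this]; simp [h2, h3]
  have h72 : (72 : k) ≠ 0 := by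
    have : (72 : k) = 2 ^ 3 * 3 ^ 2 := by norm_num
    rw [this]; simp [h2, h3]
  have h12 : (12 : k) ≠ 0 := by
    have : (12 : k) = 2 ^ 2 * 3 := by norm_num
    rw [this]; simp [h2, h3]
  have h80 : (80 : k) ≠ 0 := by
    have : (80 : k) = 2 ^ 4 * 5 := by norm_num
    rw [this]; simp [h2, h5]
  have h259 : (25 / 9 : k) ≠ 0 := by
    have : (25 / 9 : k) = 5 ^ 2 / 3 ^ 2 := by norm_num
    rw [this]; simp [h3, h5]
  constructor
  · rintro ⟨i, hi⟩
    have hf := forward x y hroots i hi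
    have hA : sumPairs x y = 0 := by
      unfold sumPairs
      rw [Finset.sum_eq_zero, mul_zero]
      intro σ _
      rcases (hf σ).1 with h | h | h <;> simp [h]
    have hB : sumB x y = 0 := by
      unfold sumB
      rw [Finset.sum_eq_zero, mul_zero]
      intro σ _
      rcases (hf σ).2 with h | h | h | h | h | h <;> simp [h]
    have hC : sumC x y = 0 := by
      unfold sumC
      rw [Finset.sum_eq_zero, mul_zero]
      intro σ _
      rcases (hf σ).2 with h | h | h | h | h | h <;> simp [h]
    refine ⟨by simp [I2r, hA], by simp [I4r, I2r, hA, hB], by simp [I6r, I2r, hA, hC], ?_⟩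
    unfold I10r
    rcases (hf 1).1 with h | h | h
    · exact Finset.prod_eq_zero (i := ((0 : Fin 6), (1 : Fin 6))) (by simp)
        (by simpa using h)
    · exact Finset.prod_eq_zero (i := ((2 : Fin 6), (3 : Fin 6))) (by simp)
        (by simpa using h)
    · exact Finset.prod_eq_zero (i := ((4 : Fin 6), (5 : Fin 6))) (by simp)
        (by simpa using h)
  · rintro ⟨hI2, hI4, hI6, hI10⟩
    have hA : sumPairs x y = 0 := by simpa [I2r, h2] using hI2
    have hB : sumB x y = 0 := by simpa [I4r, hI2, h80] using hI4
    have hC : sumC x y = 0 := by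
      rw [I6r, hI2] at hI6
      have : (25 / 9 : k) * sumC x y = 0 := by linear_combination hI6
      exact (mul_eq_zero.mp this).resolve_left h259
    have hA := (mul_eq_zero.mp hA).resolve_left (inv_ne_zero h48)
    have hB := (mul_eq_zero.mp hB).resolve_left (inv_ne_zero h72)
    have hC := (mul_eq_zero.mp hC).resolve_left (inv_ne_zero h12)
    obtain ⟨⟨i, j⟩, hij, hD⟩ := Finset.prod_eq_zero_iff.mp hI10
    simp only [Finset.mem_filter, Finset.mem_univ, true_and] at hij
    have hD : Dij x y i j = 0 := by simpa using hD
    obtain ⟨τ, h0, h1⟩ : ∃ τ : Equiv.Perm (Fin 6), τ 0 = i ∧ τ 1 = j :=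
      ⟨_, perm_move i j hij⟩
    obtain ⟨m, hm⟩ := core h2 h3 (x ∘ τ) (y ∘ τ) (fun i => hroots (τ i))
      (by simpa [Dij, h0, h1] using hD)
      (by rw [← hA]; exact Equiv.sum_comp (Equiv.mulLeft τ) (fun σ : Equiv.Perm (Fin 6) =>
            (Dij x y (σ 0) (σ 1))^2 * (Dij x y (σ 2) (σ 3))^2 * (Dij x y (σ 4) (σ 5))^2))
      (by rw [← hB]; exact Equiv.sum_comp (Equiv.mulLeft τ) (fun σ : Equiv.Perm (Fin 6) =>
            ((Dij x y (σ 0) (σ 1))^2 * (Dij x y (σ 1) (σ 2))^2 * (Dij x y (σ 2) (σ 0))^2)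
            * ((Dij x y (σ 3) (σ 4))^2 * (Dij x y (σ 4) (σ 5))^2 * (Dij x y (σ 5) (σ 3))^2)))
      (by rw [← hC]; exact Equiv.sum_comp (Equiv.mulLeft τ) (fun σ : Equiv.Perm (Fin 6) =>
            ((Dij x y (σ 0) (σ 1))^2 * (Dij x y (σ 1) (σ 2))^2 * (Dij x y (σ 2) (σ 0))^2)
            * ((Dij x y (σ 3) (σ 4))^2 * (Dij x y (σ 4) (σ 5))^2 * (Dij x y (σ 5) (σ 3))^2)
            * ((Dij x y (σ 0) (σ 3))^2 * (Dij x y (σ 1) (σ 4))^2 * (Dij x y (σ 2) (σ 5))^2)))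
    exact ⟨τ m, by rwa [← rootMult_perm]⟩
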